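/- Assume L ≥ 2. For every ℓ ∈ {1, …, L−1}, the quantity D_ℓ := (−ln(1 − a_ℓ/A_{≥ℓ})) · Σ_{j=ℓ}^{L−1} w_j · ∏_{i=1}^{j} (1 − a_i/A_{≥i}) — which equals the partial derivative ∂F̂/∂z_ℓ at the all-ones vector of the function F̂(z) = w_L + Σ_{j=1}^{L−1} w_j · (1 − ∏_{i=1}^{j} (1 − a_i/A_{≥i})^{z_i}) — satisfies (1/A_{≥1}) · (1/2 − H_{L+1−ℓ}/(L+1−ℓ)) ≤ D_ℓ ≤ (1/A_{≥1}) · (1/2), where H_j = Σ_{i=1}^{j} 1/i. -/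

import Mathlib

/-- Backward recursion `δ` indexed by distance from `L`: `deltaAux 0 = δ_L = 1`. -/
noncomputable def deltaAux : ℕ → ℝ
  | 0 => 1
  | t + 1 => 1 + ((1 + Real.sqrt (1 + 4 / deltaAux t)) / 2) * deltaAux t

/-- `δ_ℓ` for `1 ≤ ℓ ≤ L`. -/
noncomputable def deltaSeq (L ℓ : ℕ) : ℝ := deltaAux (L - ℓ)

/-- `a_ℓ = ∏_{i=1}^{ℓ-1} 1/(1 − 1/δ_i)`. -/
noncomputable def aSeq (L ℓ : ℕ) : ℝ := ∏ i ∈ Finset.Ico 1 ℓ, 1 / (1 - 1 / deltaSeq L i)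

/-- `A_{≥j} = Σ_{i=j}^{L} a_i`. -/
noncomputable def Ageq (L j : ℕ) : ℝ := ∑ i ∈ Finset.Icc j L, aSeq L i

open Finset in
theorem harmonic_sum_le (N : ℕ) : ∑ i ∈ Icc 1 N, (1 : ℝ) / i ≤ N := by
  calc ∑ i ∈ Icc 1 N, (1 : ℝ) / i ≤ ∑ _i ∈ Icc 1 N, (1 : ℝ) := by
        refine sum_le_sum fun i hi => ?_
        have : (1 : ℝ) ≤ i := by exact_mod_cast (mem_Icc.mp hi).1
        rw [div_le_one (by linarith)]
        exact this
    _ = N := by simp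

theorem deltaAux_pos (t : ℕ) : 0 < deltaAux t := by
  induction t with
  | zero => simp [deltaAux]
  | succ t ih =>
    rw [deltaAux]
    positivity

theorem one_lt_deltaAux_succ (t : ℕ) : 1 < deltaAux (t + 1) := by
  have := deltaAux_pos t
  rw [deltaAux]
  have : 0 < (1 + Real.sqrt (1 + 4 / deltaAux t)) / 2 * deltaAux t := by positivity
  linarith

theorem one_le_deltaAux (t : ℕ) : 1 ≤ deltaAux t := by
  cases t with
  | zero => simp [deltaAux]
  | succ t => exact (one_lt_deltaAux_succ t).le

theorem deltaAux_succ_sub_one_sq (t : ℕ) :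
    (deltaAux (t + 1) - 1) ^ 2 = deltaAux (t + 1) * deltaAux t := by
  have h := deltaAux_pos t
  have hs : Real.sqrt (1 + 4 / deltaAux t) ^ 2 = 1 + 4 / deltaAux t :=
    Real.sq_sqrt (by positivity)
  have hs' : deltaAux t * Real.sqrt (1 + 4 / deltaAux t) ^ 2 = deltaAux t + 4 := by
    rw [hs]
    field_simp
  rw [deltaAux]
  linear_combination deltaAux t / 4 * hs'

theorem deltaAux_succ_eq (t : ℕ) :
    deltaAux (t + 1) = deltaAux t + 2 - 1 / deltaAux (t + 1) := by
  have h := deltaAux_pos (t + 1)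
  have := deltaAux_succ_sub_one_sq t
  field_simp
  linarith

theorem deltaAux_le (t : ℕ) : deltaAux t ≤ 2 * t + 1 := by
  induction t with
  | zero => simp [deltaAux]
  | succ t ih =>
    have := deltaAux_succ_eq t
    have : 0 < 1 / deltaAux (t + 1) := one_div_pos.mpr (deltaAux_pos _)
    push_cast
    linarith

theorem add_one_le_deltaAux (t : ℕ) : (t : ℝ) + 1 ≤ deltaAux t := by
  induction t with
  | zero => simp [deltaAux]
  | succ t ih =>
    have := deltaAux_succ_eq t
    have : 1 / deltaAux (t + 1) ≤ 1 :=
      (div_le_one (deltaAux_pos _)).mpr (one_le_deltaAux _)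
    push_cast
    linarith

theorem two_mul_sub_harmonic_le_deltaAux (t : ℕ) :
    2 * ((t : ℝ) + 1) - ∑ i ∈ Finset.Icc 1 (t + 1), (1 : ℝ) / i ≤ deltaAux t := by
  induction t with
  | zero => norm_num [deltaAux]
  | succ t ih =>
    rw [Finset.sum_Icc_succ_top (by omega)]
    have := deltaAux_succ_eq t
    have : 1 / deltaAux (t + 1) ≤ 1 / ((t + 1 + 1 : ℕ) : ℝ) := by
      refine one_div_le_one_div_of_le (by positivity) ?_
      have := add_one_le_deltaAux (t + 1)
      push_cast at this ⊢
      linarith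
    push_cast at *
    linarith

theorem neg_log_mul_le (n : ℕ) :
    -Real.log (1 - 1 / deltaAux (n + 1)) * (deltaAux (n + 1) - ((n + 1 : ℕ) : ℝ) - 1) ≤ 1 / 2 := by
  have h1 := one_lt_deltaAux_succ n
  have hle := deltaAux_le (n + 1)
  have hge := add_one_le_deltaAux (n + 1)
  set d := deltaAux (n + 1)
  have hd : 0 < d - 1 := by linarith
  have hlog : -Real.log (1 - 1 / d) ≤ 1 / (d - 1) := by
    have hpos : 0 < 1 - 1 / d := by
      rw [sub_pos, div_lt_one (by linarith)]
      exact h1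
    have := Real.one_sub_inv_le_log_of_pos hpos
    have he : (1 - 1 / d)⁻¹ - 1 = 1 / (d - 1) := by
      have : d ≠ 0 := by linarith
      have := hd.ne'
      have : 1 - 1 / d = (d - 1) / d := by field_simp
      rw [this]
      field_simp
      ring
    linarith
  refine (mul_le_mul_of_nonneg_right hlog (by linarith)).trans ?_
  rw [one_div_mul_eq_div, div_le_div_iff₀ hd two_pos]
  linarith

theorem le_neg_log_mul (n : ℕ) :
    1 / 2 - (∑ i ∈ Finset.Icc 1 (n + 1 + 1), (1 : ℝ) / i) / ((n + 1 + 1 : ℕ) : ℝ) ≤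
      -Real.log (1 - 1 / deltaAux (n + 1)) * (deltaAux (n + 1) - ((n + 1 : ℕ) : ℝ) - 1) := by
  have h1 := one_lt_deltaAux_succ n
  have hge := add_one_le_deltaAux (n + 1)
  have hH := two_mul_sub_harmonic_le_deltaAux (n + 1)
  have hHN := harmonic_sum_le (n + 1 + 1)
  have hH0 : 0 ≤ ∑ i ∈ Finset.Icc 1 (n + 1 + 1), (1 : ℝ) / i :=
    Finset.sum_nonneg fun i _ => by positivity
  have hN0 : (0 : ℝ) < (n + 1 + 1 : ℕ) := by positivity
  have hN : ((n + 1 + 1 : ℕ) : ℝ) = ((n + 1 : ℕ) : ℝ) + 1 := by push_cast; ring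
  rw [← hN] at hge hH
  rw [sub_sub, ← hN]
  generalize ((n + 1 + 1 : ℕ) : ℝ) = N at *
  generalize ∑ i ∈ Finset.Icc 1 (n + 1 + 1), (1 : ℝ) / i = H at *
  generalize deltaAux (n + 1) = d at *
  have hd : 0 < d := by linarith
  have hlog : 1 / d ≤ -Real.log (1 - 1 / d) := by
    have hpos : 0 < 1 - 1 / d := by
      rw [sub_pos, div_lt_one hd]
      exact h1
    have := Real.log_le_sub_one_of_pos hpos
    linarith
  refine le_trans ?_ (mul_le_mul_of_nonneg_right hlog (by linarith))
  have key : N * N ≤ d * (N / 2 + H) := by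
    have : (2 * N - H) * (N / 2 + H) ≤ d * (N / 2 + H) :=
      mul_le_mul_of_nonneg_right hH (by linarith)
    nlinarith [mul_nonneg hH0 (sub_nonneg.mpr hHN), mul_nonneg hH0 hN0.le]
  have : N / d ≤ 1 / 2 + H / N := by
    have he : 1 / 2 + H / N = (N / 2 + H) / N := by field_simp
    rw [he, div_le_div_iff₀ hd hN0]
    linarith
  have he : 1 / d * (d - N) = 1 - N / d := by field_simp
  linarith

theorem one_lt_deltaSeq {L i : ℕ} (hi : i < L) : 1 < deltaSeq L i := by
  obtain ⟨t, ht⟩ : ∃ t, L - i = t + 1 := ⟨L - i - 1, by omega⟩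
  rw [deltaSeq, ht]
  exact one_lt_deltaAux_succ t

theorem one_sub_inv_deltaSeq_pos {L i : ℕ} (hi : i < L) : 0 < 1 - 1 / deltaSeq L i := by
  have := one_lt_deltaSeq hi
  rw [sub_pos, div_lt_one (by linarith)]
  exact this

theorem aSeq_pos {L j : ℕ} (hj : j ≤ L) : 0 < aSeq L j :=
  Finset.prod_pos fun i hi =>
    one_div_pos.mpr (one_sub_inv_deltaSeq_pos (by rw [Finset.mem_Ico] at hi; omega))

theorem deltaSeq_of_add_succ {L ℓ n : ℕ} (h : ℓ + (n + 1) = L) :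
    deltaSeq L ℓ = deltaAux (n + 1) ∧ deltaSeq L (ℓ + 1) = deltaAux n := by
  subst h
  constructor <;> unfold deltaSeq <;> congr 1 <;> omega

theorem Ageq_eq_deltaSeq_mul {L ℓ n : ℕ} (h : (ℓ + 1) + n = L) :
    Ageq L (ℓ + 1) = deltaSeq L (ℓ + 1) * aSeq L (ℓ + 1) := by
  induction n generalizing ℓ with
  | zero =>
    obtain rfl : ℓ + 1 = L := h
    simp [Ageq, deltaSeq, deltaAux]
  | succ n ih =>
    have hstep : Ageq L (ℓ + 1) = aSeq L (ℓ + 1) + Ageq L (ℓ + 1 + 1) := by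
      unfold Ageq
      rw [← Finset.Ico_add_one_right_eq_Icc, ← Finset.Ico_add_one_right_eq_Icc,
        Finset.sum_eq_sum_Ico_succ_bot (by omega)]
    have ha : aSeq L (ℓ + 1 + 1) = aSeq L (ℓ + 1) * (1 / (1 - 1 / deltaSeq L (ℓ + 1))) := by
      unfold aSeq
      rw [Finset.prod_Ico_succ_top (by omega)]
    have hd := deltaSeq_of_add_succ h
    have hsq := deltaAux_succ_sub_one_sq n
    have h1 := one_lt_deltaAux_succ n
    rw [hstep, ih (by omega), ha, hd.1, hd.2]
    generalize deltaAux (n + 1) = x at *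
    have hx : x ≠ 0 := by linarith
    have hx1 : x - 1 ≠ 0 := by linarith
    have he : 1 / (1 - 1 / x) = x / (x - 1) := by
      rw [one_sub_div hx, one_div_div]
    rw [he]
    field_simp
    linear_combination -aSeq L (ℓ + 1) * hsq

theorem aSeq_div_Ageq {L ℓ : ℕ} (h : 1 ≤ ℓ ∧ ℓ ≤ L) :
    aSeq L ℓ / Ageq L ℓ = 1 / deltaSeq L ℓ := by
  obtain ⟨m, rfl⟩ : ∃ m, ℓ = m + 1 := ⟨ℓ - 1, by omega⟩
  have := (aSeq_pos h.2).ne'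
  rw [Ageq_eq_deltaSeq_mul (Nat.add_sub_cancel' h.2)]
  field_simp

theorem aSeq_mul_prod {L j : ℕ} (h1 : 1 ≤ j) (hj : j < L) :
    aSeq L j * ∏ i ∈ Finset.Icc 1 j, (1 - aSeq L i / Ageq L i) = 1 - 1 / deltaSeq L j := by
  have hp : ∏ i ∈ Finset.Icc 1 j, (1 - aSeq L i / Ageq L i) =
      ∏ i ∈ Finset.Icc 1 j, (1 - 1 / deltaSeq L i) := by
    refine Finset.prod_congr rfl fun i hi => ?_
    rw [Finset.mem_Icc] at hi
    rw [aSeq_div_Ageq (by omega)]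
  rw [hp, ← Finset.Ico_add_one_right_eq_Icc, Finset.prod_Ico_succ_top h1, ← mul_assoc, aSeq,
    ← Finset.prod_mul_distrib, Finset.prod_eq_one, one_mul]
  intro i hi
  rw [Finset.mem_Ico] at hi
  exact one_div_mul_cancel (one_sub_inv_deltaSeq_pos (by omega)).ne'

theorem sum_one_sub_inv_deltaSeq {L ℓ n : ℕ} (h : ℓ + n = L) :
    ∑ j ∈ Finset.Ico ℓ L, (1 - 1 / deltaSeq L j) = deltaSeq L ℓ - n - 1 := by
  induction n generalizing ℓ with
  | zero =>
    obtain rfl : ℓ = L := h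
    simp [deltaSeq, deltaAux]
  | succ n ih =>
    have hd := deltaSeq_of_add_succ h
    rw [Finset.sum_eq_sum_Ico_succ_bot (by omega), ih (by omega), hd.1, hd.2]
    have := deltaAux_succ_eq n
    push_cast
    linarith

/-- For `L ≥ 2` and `1 ≤ ℓ ≤ L−1`, the quantity
`D_ℓ = (−ln(1 − a_ℓ/A_{≥ℓ})) · Σ_{j=ℓ}^{L−1} w_j · ∏_{i=1}^{j} (1 − a_i/A_{≥i})`
(the partial derivative `∂F̂/∂z_ℓ` at the all-ones vector) satisfies
`(1/A_{≥1})·(1/2 − H_{L+1−ℓ}/(L+1−ℓ)) ≤ D_ℓ ≤ (1/A_{≥1})·(1/2)`. -/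
theorem stmt_11 (L : ℕ) (hL : 2 ≤ L) (ℓ : ℕ) (hℓ1 : 1 ≤ ℓ) (hℓL : ℓ ≤ L - 1) :
    (1 / Ageq L 1) *
        (1 / 2 - (∑ i ∈ Finset.Icc 1 (L + 1 - ℓ), (1 : ℝ) / i) / ((L + 1 - ℓ : ℕ) : ℝ)) ≤
      (-Real.log (1 - aSeq L ℓ / Ageq L ℓ)) *
        ∑ j ∈ Finset.Icc ℓ (L - 1),
          (aSeq L j / Ageq L 1) * ∏ i ∈ Finset.Icc 1 j, (1 - aSeq L i / Ageq L i) ∧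
    (-Real.log (1 - aSeq L ℓ / Ageq L ℓ)) *
        ∑ j ∈ Finset.Icc ℓ (L - 1),
          (aSeq L j / Ageq L 1) * ∏ i ∈ Finset.Icc 1 j, (1 - aSeq L i / Ageq L i) ≤
      (1 / Ageq L 1) * (1 / 2) := by
  obtain ⟨n, hn⟩ : ∃ n, ℓ + (n + 1) = L := ⟨L - 1 - ℓ, by omega⟩
  have hsum : ∑ j ∈ Finset.Icc ℓ (L - 1),
      (aSeq L j / Ageq L 1) * ∏ i ∈ Finset.Icc 1 j, (1 - aSeq L i / Ageq L i) =
      1 / Ageq L 1 * (deltaAux (n + 1) - ((n + 1 : ℕ) : ℝ) - 1) := by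
    have hIcc : Finset.Icc ℓ (L - 1) = Finset.Ico ℓ L := by
      ext x
      simp only [Finset.mem_Icc, Finset.mem_Ico]
      omega
    have hδ : deltaAux (n + 1) = deltaSeq L ℓ := by
      rw [deltaSeq, ← hn, Nat.add_sub_cancel_left]
    rw [hIcc, hδ, ← sum_one_sub_inv_deltaSeq hn, Finset.mul_sum]
    refine Finset.sum_congr rfl fun j hj => ?_
    rw [Finset.mem_Ico] at hj
    rw [← aSeq_mul_prod (by omega : 1 ≤ j) hj.2]
    ring
  have hdiv : aSeq L ℓ / Ageq L ℓ = 1 / deltaAux (n + 1) := by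
    rw [aSeq_div_Ageq (by omega), deltaSeq, ← hn, Nat.add_sub_cancel_left]
  have hN : L + 1 - ℓ = n + 1 + 1 := by omega
  have hA : 0 ≤ 1 / Ageq L 1 := by
    have := one_le_deltaAux (L - 1)
    have := aSeq_pos (show 1 ≤ L by omega)
    rw [Ageq_eq_deltaSeq_mul (show 1 + (L - 1) = L by omega), deltaSeq]
    positivity
  rw [hsum, hdiv, hN, mul_left_comm]
  exact ⟨mul_le_mul_of_nonneg_left (le_neg_log_mul n) hA,
    mul_le_mul_of_nonneg_left (neg_log_mul_le n) hA⟩
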